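/- arXiv:1201.3504 — 2 statements merged into one kernel-verified Lean document; each statement's English description precedes it below -/
import Mathlib

section
/- Fix n ≥ 1 and 1 ≤ k ≤ 1+n. For every k-form ω on V = ℝ^{1+n} and every observer U, with electric part E_U := U* ∧ i_U ω and magnetic part B_U := i_U (U* ∧ ω): one has ⟨E_U, E_U⟩ = ⟨i_U ω, i_U ω⟩; moreover (−1)^{k−1} ⟨E_U, E_U⟩ ≥ 0 and (−1)^{k} ⟨B_U, B_U⟩ ≥ 0 (so the quantities |E_U|² := (−1)^{k−1}⟨i_U ω, i_U ω⟩ and |B_U|² := (−1)^{k}⟨U* ∧ ω, U* ∧ ω⟩ are nonnegative). -/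
namespace Paper

noncomputable section

/-- The vector space `V = ℝ^{1+n}`. -/
abbrev V (n : ℕ) := Fin (n + 1) → ℝ

/-- The standard basis vectors `e₀, …, e_n`. -/
def eb (n : ℕ) (i : Fin (n + 1)) : V n := Pi.single i 1

/-- The signs `ε₀ = 1`, `ε_i = -1` for `i ≠ 0`. -/
def eps (n : ℕ) (i : Fin (n + 1)) : ℝ := if i = 0 then 1 else -1

/-- The Minkowski bilinear form `η(x,y) = x₀y₀ − Σᵢ xᵢyᵢ`. -/
def mink (n : ℕ) (x y : V n) : ℝ := ∑ i, eps n i * x i * y i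

/-- An observer: a unitary timelike vector oriented to the future. -/
def IsObserver (n : ℕ) (U : V n) : Prop := mink n U U = 1 ∧ 0 < mink n U (eb n 0)

open Classical in
/-- The induced scalar product of two (raw) `k`-forms:
`⟨ω, ω̄⟩ = Σ_{i₁ < ⋯ < i_k} ε_{i₁}⋯ε_{i_k} ω(e_{i₁},…,e_{i_k}) ω̄(e_{i₁},…,e_{i_k})`. -/
def finner (n k : ℕ) (ω ω' : (Fin k → V n) → ℝ) : ℝ :=
  ∑ v ∈ Finset.univ.filter (fun v : Fin k → Fin (n + 1) => StrictMono v),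
    (∏ j, eps n (v j)) * ω (fun j => eb n (v j)) * ω' (fun j => eb n (v j))

/-- Interior product `i_D ω = ω(D, −, …, −)` of a vector with a (raw) `k`-form. -/
def inter (n k : ℕ) (D : V n) (ω : (Fin k → V n) → ℝ) : (Fin (k - 1) → V n) → ℝ :=
  fun v => ω (fun j => if h : (j : ℕ) = 0 then D
    else v ⟨(j : ℕ) - 1, by have := j.isLt; omega⟩)

/-- The metrically equivalent `1`-form `U* = η(U, −)`. -/
def ustar (n : ℕ) (U : V n) : V n → ℝ := fun w => mink n U w

/-- Wedge product of a `1`-form with a (raw) `k`-form: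
`(α ∧ ω)(v₀,…,v_k) = Σ_j (−1)^j α(v_j) ω(v₀,…,v̂_j,…,v_k)`. -/
def wedge1 (n k : ℕ) (α : V n → ℝ) (ω : (Fin k → V n) → ℝ) : (Fin (k + 1) → V n) → ℝ :=
  fun v => ∑ j : Fin (k + 1), (-1 : ℝ) ^ (j : ℕ) * α (v j) * ω (v ∘ j.succAbove)

/-- The electric part `E_U = U* ∧ i_U ω` of a `k`-form with respect to an observer `U`. -/
def EU (n k : ℕ) (U : V n) (ω : (Fin k → V n) → ℝ) : (Fin (k - 1 + 1) → V n) → ℝ :=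
  wedge1 n (k - 1) (ustar n U) (inter n k U ω)

/-- The magnetic part `B_U = i_U (U* ∧ ω)` of a `k`-form with respect to an observer `U`. -/
def BU (n k : ℕ) (U : V n) (ω : (Fin k → V n) → ℝ) : (Fin k → V n) → ℝ :=
  inter n (k + 1) U (wedge1 n k (ustar n U) ω)

/-- Reindexing a raw form along an equality of degrees. -/
def reind (n : ℕ) {m m' : ℕ} (h : m = m') (ω : (Fin m → V n) → ℝ) : (Fin m' → V n) → ℝ :=
  fun v => ω (fun j => v (Fin.cast h j))

/-- The energy tensor of a `k`-form:
`(−1)^{k−1} T(D₁,D₂) = ⟨i_{D₁}ω, i_{D₂}ω⟩ − (1/2)⟨ω,ω⟩ η(D₁,D₂)`. -/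
def energyT (n k : ℕ) (ω : (Fin k → V n) → ℝ) (D₁ D₂ : V n) : ℝ :=
  (-1 : ℝ) ^ (k - 1) * (finner n (k - 1) (inter n k D₁ ω) (inter n k D₂ ω)
    - (1 / 2) * finner n k ω ω * mink n D₁ D₂)

/-- The volume form `dX`, with `dX(e₀,…,e_n) = 1`. -/
def dX (n : ℕ) (u : Fin (n + 1) → V n) : ℝ := Matrix.det (Matrix.of fun i j => u i j)

/-- The Hodge star of a (raw) `k`-form:
`(*ω)(v₁,…,v_{1+n−k}) = (1/k!) Σ_{i₁,…,i_k} ε_{i₁}⋯ε_{i_k} ω(e_{i₁},…,e_{i_k})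
  dX(e_{i₁},…,e_{i_k},v₁,…,v_{1+n−k})`. -/
def hodge (n k : ℕ) (ω : (Fin k → V n) → ℝ) : (Fin (n + 1 - k) → V n) → ℝ :=
  fun v => (1 / (k.factorial : ℝ)) * ∑ i : Fin k → Fin (n + 1),
    (∏ j, eps n (i j)) * ω (fun j => eb n (i j)) *
      dX n (fun l => if h : (l : ℕ) < k then eb n (i ⟨(l : ℕ), h⟩)
        else v ⟨(l : ℕ) - k, by have := l.isLt; omega⟩)

/-- The bilinear form associated to a matrix `g`. -/
def gbil (n : ℕ) (g : Matrix (Fin (n + 1)) (Fin (n + 1)) ℝ) (x y : V n) : ℝ :=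
  ∑ a, ∑ b, g a b * x a * y b

/-- The scalar product of two (raw) `k`-forms with respect to a metric `g` (indices raised
with the inverse matrix `g⁻¹`):
`⟨ω,ω̄⟩_g = (1/k!) Σ g^{i₁j₁}⋯g^{i_kj_k} ω_{i₁…i_k} ω̄_{j₁…j_k}`. -/
def ginner (n : ℕ) (g : Matrix (Fin (n + 1)) (Fin (n + 1)) ℝ) (k : ℕ)
    (ω ω' : (Fin k → V n) → ℝ) : ℝ :=
  (1 / (k.factorial : ℝ)) * ∑ v : Fin k → Fin (n + 1), ∑ w : Fin k → Fin (n + 1),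
    (∏ j, g⁻¹ (v j) (w j)) * ω (fun j => eb n (v j)) * ω' (fun j => eb n (w j))

/-- The energy tensor of a `k`-form with respect to a metric `g`:
`T(g,ω)(D₁,D₂) = (−1)^{k−1}( ⟨i_{D₁}ω, i_{D₂}ω⟩_g − (1/2)⟨ω,ω⟩_g g(D₁,D₂) )`. -/
def energyTg (n : ℕ) (g : Matrix (Fin (n + 1)) (Fin (n + 1)) ℝ) (k : ℕ)
    (ω : (Fin k → V n) → ℝ) (D₁ D₂ : V n) : ℝ :=
  (-1 : ℝ) ^ (k - 1) * (ginner n g (k - 1) (inter n k D₁ ω) (inter n k D₂ ω)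
    - (1 / 2) * ginner n g k ω ω * gbil n g D₁ D₂)

end

end Paper

namespace Paper

section

open Finset

theorem sum_eq_factorial_mul_sum_strictMono {k m : ℕ} (g : (Fin k → Fin m) → ℝ)
    (hperm : ∀ v (σ : Equiv.Perm (Fin k)), g (v ∘ σ) = g v)
    (hinj : ∀ v, ¬ Function.Injective v → g v = 0)
    [DecidablePred fun v : Fin k → Fin m => StrictMono v] :
    ∑ v, g v = (k.factorial : ℝ) * ∑ v ∈ univ.filter (fun v => StrictMono v), g v := by
  classical
  have hsplit : ∑ v ∈ univ.filter (fun v : Fin k → Fin m => Function.Injective v), g v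
      = ∑ v, g v := by
    refine sum_subset (subset_univ _) fun v _ hv => hinj v ?_
    simpa using hv
  have hprod : ∑ p ∈ (univ.filter (fun v : Fin k → Fin m => StrictMono v)) ×ˢ
      (univ : Finset (Equiv.Perm (Fin k))), g p.1
      = ∑ v ∈ univ.filter (fun v : Fin k → Fin m => Function.Injective v), g v := by
    refine sum_bij (fun p _ => p.1 ∘ p.2) ?_ ?_ ?_ ?_
    · intro p hp
      simp only [mem_product, mem_filter, mem_univ, true_and, and_true] at hp ⊢
      exact hp.injective.comp p.2.injective
    · rintro ⟨s, σ⟩ hp ⟨t, τ⟩ hq h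
      simp only [mem_product, mem_filter, mem_univ, true_and, and_true] at hp hq h
      have hst : s = t := by
        refine (StrictMono.range_inj hp hq).1 ?_
        rw [← σ.surjective.range_comp s, h, τ.surjective.range_comp t]
      subst hst
      refine Prod.ext rfl (Equiv.ext fun i => hp.injective (congrFun h i))
    · intro v hv
      simp only [mem_filter, mem_univ, true_and] at hv
      refine ⟨(v ∘ Tuple.sort v, (Tuple.sort v).symm), ?_, ?_⟩
      · simp only [mem_product, mem_filter, mem_univ, true_and, and_true]
        exact (Tuple.monotone_sort v).strictMono_of_injective
          (hv.comp (Tuple.sort v).injective)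
      · ext i; simp
    · intro p _
      exact (hperm _ _).symm
  rw [← hsplit, ← hprod, sum_product]
  simp [mul_sum, Fintype.card_perm]

/-- The contraction of two raw `k`-forms over all multi-indices, not only the increasing ones. -/
noncomputable def fullInner (n k : ℕ) (ω ω' : (Fin k → V n) → ℝ) : ℝ :=
  ∑ v : Fin k → Fin (n + 1),
    (∏ j, eps n (v j)) * ω (fun j => eb n (v j)) * ω' (fun j => eb n (v j))

theorem fullInner_eq_factorial_mul_finner {n k : ℕ} (α β : V n [⋀^Fin k]→ₗ[ℝ] ℝ) :
    fullInner n k α β = (k.factorial : ℝ) * finner n k α β := by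
  classical
  refine (sum_eq_factorial_mul_sum_strictMono _ ?_ ?_).trans ?_
  · intro v σ
    have h1 : ∏ j, eps n ((v ∘ σ) j) = ∏ j, eps n (v j) :=
      Equiv.prod_comp σ (fun j => eps n (v j))
    have h2 : ∀ γ : V n [⋀^Fin k]→ₗ[ℝ] ℝ, γ (fun j => eb n ((v ∘ σ) j))
        = Equiv.Perm.sign σ • γ (fun j => eb n (v j)) :=
      fun γ => γ.map_perm (fun j => eb n (v j)) σ
    rw [h1, h2, h2]
    rcases Int.units_eq_one_or (Equiv.Perm.sign σ) with h | h <;> simp [h]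
  · intro v hv
    rw [α.map_eq_zero_of_not_injective _ fun h => hv fun i j hij => h (by simp [hij])]
    simp
  · simp only [finner]

theorem sum_insertNth {m k : ℕ} (j : Fin (k + 1)) (f : (Fin (k + 1) → Fin m) → ℝ) :
    ∑ v, f v = ∑ i : Fin m, ∑ w : Fin k → Fin m, f (j.insertNth i w) := by
  rw [← Fintype.sum_prod_type']
  exact (Equiv.sum_comp (Fin.insertNthEquiv (fun _ => Fin m) j) f).symm

theorem eb_insertNth {n k : ℕ} (j : Fin (k + 1)) (i : Fin (n + 1)) (w : Fin k → Fin (n + 1)) :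
    (fun l => eb n ((j.insertNth i w : Fin (k + 1) → Fin (n + 1)) l))
      = (j.insertNth (eb n i) (fun l => eb n (w l)) : Fin (k + 1) → V n) := by
  funext l
  refine Fin.succAboveCases j ?_ (fun l => ?_) l <;> simp

/-- The linear form `x ↦ α(x, w)`. -/
def firstSlot {n k : ℕ} (α : V n [⋀^Fin (k + 1)]→ₗ[ℝ] ℝ) (w : Fin k → V n) : V n →ₗ[ℝ] ℝ where
  toFun x := α.curryLeft x w
  map_add' x y := by rw [map_add]; rfl
  map_smul' c x := by rw [map_smul]; rfl

@[simp]
theorem firstSlot_apply {n k : ℕ} (α : V n [⋀^Fin (k + 1)]→ₗ[ℝ] ℝ) (w : Fin k → V n) (x : V n) :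
    firstSlot α w x = α (Matrix.vecCons x w) := rfl

theorem linearMap_apply_eq_sum {n : ℕ} (f : V n →ₗ[ℝ] ℝ) (x : V n) :
    f x = ∑ i, x i * f (eb n i) := by
  conv_lhs => rw [pi_eq_sum_univ' x]
  simp only [map_sum, map_smul, smul_eq_mul, eb]

theorem ustar_eb {n : ℕ} (U : V n) (i : Fin (n + 1)) : ustar n U (eb n i) = eps n i * U i := by
  simp [ustar, mink, eb, Pi.single_apply]

theorem eps_mul_self (n : ℕ) (i : Fin (n + 1)) : eps n i * eps n i = 1 := by
  unfold eps; split_ifs <;> norm_num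

/-- The linear form `U* = η(U, −)`. -/
noncomputable def ustarLin (n : ℕ) (U : V n) : V n →ₗ[ℝ] ℝ where
  toFun := ustar n U
  map_add' x y := by simp [ustar, mink, mul_add, sum_add_distrib]
  map_smul' c x := by
    simp only [ustar, mink, Pi.smul_apply, smul_eq_mul, mul_sum, RingHom.id_apply]
    exact sum_congr rfl fun i _ => by ring

@[simp]
theorem ustarLin_apply {n : ℕ} (U x : V n) : ustarLin n U x = ustar n U x := rfl

/-- The alternating form `U* ∧ α`. -/
noncomputable def wedgeAlt {n k : ℕ} (U : V n) (α : V n [⋀^Fin k]→ₗ[ℝ] ℝ) :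
    V n [⋀^Fin (k + 1)]→ₗ[ℝ] ℝ :=
  AlternatingMap.alternatizeUncurryFin ((ustarLin n U).smulRight α)

theorem wedgeAlt_apply {n k : ℕ} (U : V n) (α : V n [⋀^Fin k]→ₗ[ℝ] ℝ) (v : Fin (k + 1) → V n) :
    wedgeAlt U α v
      = ∑ j : Fin (k + 1), (-1 : ℝ) ^ (j : ℕ) * (ustar n U (v j) * α (j.removeNth v)) := by
  simp [wedgeAlt, AlternatingMap.alternatizeUncurryFin_apply]

theorem coe_wedgeAlt {n k : ℕ} (U : V n) (α : V n [⋀^Fin k]→ₗ[ℝ] ℝ) :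
    ⇑(wedgeAlt U α) = wedge1 n k (ustar n U) α := by
  funext v
  rw [wedgeAlt_apply]
  exact sum_congr rfl fun j _ => (mul_assoc _ _ _).symm

theorem coe_curryLeft {n k : ℕ} (U : V n) (α : V n [⋀^Fin (k + 1)]→ₗ[ℝ] ℝ) :
    ⇑(α.curryLeft U) = inter n (k + 1) U α := by
  funext v
  simp only [AlternatingMap.curryLeft_apply_apply, inter]
  congr 1
  funext j
  refine Fin.cases ?_ (fun j => ?_) j <;> simp

theorem fullInner_wedgeAlt {n k : ℕ} (U : V n) (α : V n [⋀^Fin k]→ₗ[ℝ] ℝ)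
    (β : V n [⋀^Fin (k + 1)]→ₗ[ℝ] ℝ) :
    fullInner n (k + 1) (wedgeAlt U α) β = (k + 1) * fullInner n k α (β.curryLeft U) := by
  have hterm : ∀ j : Fin (k + 1), ∑ v : Fin (k + 1) → Fin (n + 1),
      (∏ l, eps n (v l)) * ((-1 : ℝ) ^ (j : ℕ) * (ustar n U (eb n (v j)) *
        α (j.removeNth fun l => eb n (v l)))) * β (fun l => eb n (v l))
      = fullInner n k α (β.curryLeft U) := by
    intro j
    rw [sum_insertNth j, sum_comm]
    refine sum_congr rfl fun w _ => ?_
    have hU := linearMap_apply_eq_sum (firstSlot β fun l => eb n (w l)) U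
    simp only [firstSlot_apply] at hU
    rw [AlternatingMap.curryLeft_apply_apply, hU, mul_sum]
    refine sum_congr rfl fun i _ => ?_
    have hβ := β.map_insertNth j (eb n i) (fun l => eb n (w l))
    rw [eb_insertNth, hβ, Fin.prod_univ_succAbove _ j, Fin.removeNth_insertNth]
    simp only [Fin.insertNth_apply_same, Fin.insertNth_apply_succAbove, ustar_eb,
      zsmul_eq_mul]
    push_cast
    have h1 := eps_mul_self n i
    have h2 : (-1 : ℝ) ^ (j : ℕ) * (-1 : ℝ) ^ (j : ℕ) = 1 := by
      rw [← mul_pow]; norm_num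
    linear_combination ((∏ l, eps n (w l)) * α (fun l => eb n (w l)) * U i *
      β (Matrix.vecCons (eb n i) fun l => eb n (w l))) *
      ((-1 : ℝ) ^ (j : ℕ) * (-1 : ℝ) ^ (j : ℕ) * h1 + h2)
  simp only [fullInner, wedgeAlt_apply, mul_sum, sum_mul]
  rw [sum_comm]
  simp only [← mul_sum]
  rw [sum_congr rfl fun j _ => hterm j]
  simp [fullInner, mul_sum]

theorem finner_wedgeAlt {n k : ℕ} (U : V n) (α : V n [⋀^Fin k]→ₗ[ℝ] ℝ)
    (β : V n [⋀^Fin (k + 1)]→ₗ[ℝ] ℝ) :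
    finner n (k + 1) (wedgeAlt U α) β = finner n k α (β.curryLeft U) := by
  have h := fullInner_wedgeAlt U α β
  rw [fullInner_eq_factorial_mul_finner, fullInner_eq_factorial_mul_finner,
    Nat.factorial_succ] at h
  push_cast at h
  have hk : ((k : ℝ) + 1) * (k.factorial : ℝ) ≠ 0 := by positivity
  exact mul_left_cancel₀ hk (by linear_combination h)

theorem curryLeft_wedgeAlt_apply {n k : ℕ} {U : V n} (hU : mink n U U = 1)
    (α : V n [⋀^Fin k]→ₗ[ℝ] ℝ) (v : Fin k → V n) :
    (wedgeAlt U α).curryLeft U v = α v + ∑ j : Fin k, (-1 : ℝ) ^ ((j : ℕ) + 1) *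
      (ustar n U (v j) * α (j.succ.removeNth (Matrix.vecCons U v : Fin (k + 1) → V n))) := by
  rw [AlternatingMap.curryLeft_apply_apply, wedgeAlt_apply, Fin.sum_univ_succ]
  congr 1
  simp [ustar, hU, Matrix.vecCons]

theorem curryLeft_wedgeAlt {n k : ℕ} {U : V n} (hU : mink n U U = 1)
    (α : V n [⋀^Fin (k + 1)]→ₗ[ℝ] ℝ) :
    (wedgeAlt U α).curryLeft U = α - wedgeAlt U (α.curryLeft U) := by
  ext v
  rw [curryLeft_wedgeAlt_apply hU, AlternatingMap.sub_apply, wedgeAlt_apply, sub_eq_add_neg,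
    ← sum_neg_distrib]
  congr 1
  refine sum_congr rfl fun j _ => ?_
  have : j.succ.removeNth (Matrix.vecCons U v : Fin (k + 2) → V n)
      = Matrix.vecCons U (j.removeNth v) := by
    funext l
    refine Fin.cases ?_ (fun l => ?_) l <;> simp [Fin.removeNth]
  rw [this, AlternatingMap.curryLeft_apply_apply]
  ring

theorem curryLeft_wedgeAlt_curryLeft {n k : ℕ} {U : V n} (hU : mink n U U = 1)
    (α : V n [⋀^Fin (k + 1)]→ₗ[ℝ] ℝ) :
    (wedgeAlt U (α.curryLeft U)).curryLeft U = α.curryLeft U := by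
  ext v
  rw [curryLeft_wedgeAlt_apply hU, add_eq_left]
  refine sum_eq_zero fun j _ => ?_
  have : (α.curryLeft U) (j.succ.removeNth (Matrix.vecCons U v : Fin (k + 1) → V n)) = 0 := by
    rw [AlternatingMap.curryLeft_apply_apply]
    obtain ⟨m, rfl⟩ : ∃ m, k = m + 1 := ⟨k - 1, by have := j.pos; omega⟩
    exact α.map_eq_zero_of_eq (i := 0) (j := 1) _ (by simp [Fin.removeNth]) (by simp)
  rw [this]; ring

/-- The image of `e_i`, `i ≠ 0`, under the boost that sends `e₀` to `U`. -/
noncomputable def boost (n : ℕ) (U : V n) (i : Fin n) : V n :=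
  eb n i.succ + (U i.succ / (1 + U 0)) • (U + eb n 0)

theorem sum_eps_mul_sq_eq_sum_boost {n : ℕ} {U : V n} (hU : IsObserver n U) (f : V n →ₗ[ℝ] ℝ)
    (hf : f U = 0) :
    ∑ i, -eps n i * f (eb n i) ^ 2 = ∑ i : Fin n, f (boost n U i) ^ 2 := by
  obtain ⟨h1, h2⟩ := hU
  have h0 : 0 < U 0 := by simpa [mink, eb, eps, Pi.single_apply] using h2
  have hfU := linearMap_apply_eq_sum f U
  rw [hf, Fin.sum_univ_succ] at hfU
  simp only [mink, Fin.sum_univ_succ, eps, if_true, Fin.succ_ne_zero, if_false] at h1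
  have hsq : ∑ i : Fin n, U i.succ ^ 2 = U 0 ^ 2 - 1 := by
    have : ∑ i : Fin n, -1 * U i.succ * U i.succ = - ∑ i : Fin n, U i.succ ^ 2 := by
      rw [← sum_neg_distrib]; exact sum_congr rfl fun i _ => by ring
    rw [this] at h1; linarith
  have hexp : ∀ i : Fin n, f (boost n U i) ^ 2 = f (eb n i.succ) ^ 2
      + 2 * f (eb n 0) / (1 + U 0) * (U i.succ * f (eb n i.succ))
      + (f (eb n 0) / (1 + U 0)) ^ 2 * U i.succ ^ 2 := by
    intro i
    simp only [boost, map_add, map_smul, smul_eq_mul, hf]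
    ring
  rw [Fin.sum_univ_succ, sum_congr rfl fun i _ => hexp i, sum_add_distrib, sum_add_distrib,
    ← mul_sum, ← mul_sum, hsq]
  have hS : ∑ i : Fin n, U i.succ * f (eb n i.succ) = - (U 0 * f (eb n 0)) := by linarith
  rw [hS]
  simp only [eps, if_true, Fin.succ_ne_zero, if_false, neg_neg, one_mul]
  have : (1 + U 0) ≠ 0 := by positivity
  field_simp
  ring

theorem sum_prod_neg_eps_mul_sq_nonneg {n : ℕ} {U : V n} (hU : IsObserver n U) :
    ∀ {k : ℕ} (α : V n [⋀^Fin k]→ₗ[ℝ] ℝ), (∀ v j, v j = U → α v = 0) →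
      0 ≤ ∑ v : Fin k → Fin (n + 1), (∏ j, -eps n (v j)) * α (fun j => eb n (v j)) ^ 2
  | 0, α, _ => by
    refine sum_nonneg fun v _ => ?_
    simp only [univ_eq_empty, prod_empty, one_mul]
    positivity
  | k + 1, α, hα => by
    have key : ∑ v : Fin (k + 1) → Fin (n + 1), (∏ j, -eps n (v j)) * α (fun j => eb n (v j)) ^ 2
        = ∑ i : Fin n, ∑ w : Fin k → Fin (n + 1),
          (∏ j, -eps n (w j)) * α.curryLeft (boost n U i) (fun j => eb n (w j)) ^ 2 := by
      rw [sum_insertNth 0, sum_comm, sum_comm (s := (univ : Finset (Fin n)))]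
      refine sum_congr rfl fun w _ => ?_
      have h := sum_eps_mul_sq_eq_sum_boost hU (firstSlot α fun l => eb n (w l)) (hα _ 0 rfl)
      simp only [firstSlot_apply] at h
      simp only [AlternatingMap.curryLeft_apply_apply]
      rw [← mul_sum, ← h, mul_sum]
      refine sum_congr rfl fun i _ => ?_
      rw [eb_insertNth, Fin.prod_univ_succ]
      simp only [Fin.insertNth_zero', Fin.cons_zero, Fin.cons_succ, Matrix.vecCons]
      ring
    rw [key]
    refine sum_nonneg fun i _ => sum_prod_neg_eps_mul_sq_nonneg hU _ fun v j hv => ?_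
    exact hα _ j.succ (by simpa using hv)

theorem neg_one_pow_mul_finner_self_nonneg {n k : ℕ} {U : V n} (hU : IsObserver n U)
    (α : V n [⋀^Fin k]→ₗ[ℝ] ℝ) (hα : ∀ v j, v j = U → α v = 0) :
    0 ≤ (-1 : ℝ) ^ k * finner n k α α := by
  have h := sum_prod_neg_eps_mul_sq_nonneg hU α hα
  have heq : ∑ v : Fin k → Fin (n + 1), (∏ j, -eps n (v j)) * α (fun j => eb n (v j)) ^ 2
      = (k.factorial : ℝ) * ((-1 : ℝ) ^ k * finner n k α α) := by
    rw [mul_left_comm, ← fullInner_eq_factorial_mul_finner, fullInner, mul_sum]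
    refine sum_congr rfl fun v _ => ?_
    rw [prod_neg]
    simp only [card_univ, Fintype.card_fin]
    ring
  rw [heq] at h
  exact nonneg_of_mul_nonneg_right h (by positivity)

theorem curryLeft_apply_eq_zero_of_eq {n k : ℕ} (U : V n) (α : V n [⋀^Fin (k + 1)]→ₗ[ℝ] ℝ)
    (v : Fin k → V n) (j : Fin k) (hv : v j = U) : α.curryLeft U v = 0 :=
  α.map_eq_zero_of_eq (i := 0) (j := j.succ) _ (by simp [hv]) (Fin.succ_ne_zero j).symm

theorem finner_add_left {n k : ℕ} (α β γ : (Fin k → V n) → ℝ) :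
    finner n k (α + β) γ = finner n k α γ + finner n k β γ := by
  simp only [finner, ← sum_add_distrib, Pi.add_apply]
  exact sum_congr rfl fun v _ => by ring

theorem finner_wedgeAlt_self {n k : ℕ} {U : V n} (hU : mink n U U = 1)
    (α : V n [⋀^Fin (k + 1)]→ₗ[ℝ] ℝ) :
    finner n (k + 2) (wedgeAlt U α) (wedgeAlt U α)
      = finner n (k + 1) ((wedgeAlt U α).curryLeft U) ((wedgeAlt U α).curryLeft U) := by
  have hdec : (⇑α : (Fin (k + 1) → V n) → ℝ)
      = ⇑((wedgeAlt U α).curryLeft U) + ⇑(wedgeAlt U (α.curryLeft U)) := by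
    rw [curryLeft_wedgeAlt hU]
    funext v
    simp
  have h0 : finner n (k + 1) (wedgeAlt U (α.curryLeft U)) ((wedgeAlt U α).curryLeft U) = 0 := by
    rw [finner_wedgeAlt, AlternatingMap.curryLeft_same]
    simp [finner]
  rw [finner_wedgeAlt]
  conv_lhs => enter [3]; rw [hdec]
  rw [finner_add_left, h0, add_zero]

end

/-- `⟨E_U,E_U⟩ = ⟨i_Uω, i_Uω⟩`, and the signs
`(−1)^{k−1}⟨E_U,E_U⟩ ≥ 0`, `(−1)^k⟨B_U,B_U⟩ ≥ 0`, so `|E_U|² ≥ 0` and `|B_U|² ≥ 0`. -/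
theorem statement8 (n k : ℕ) (hn : 1 ≤ n) (hk1 : 1 ≤ k) (hk2 : k ≤ n + 1)
    (ω : AlternatingMap ℝ (V n) ℝ (Fin k)) (U : V n) (hU : IsObserver n U) :
    finner n k (reind n (by omega : k - 1 + 1 = k) (EU n k U ⇑ω))
        (reind n (by omega : k - 1 + 1 = k) (EU n k U ⇑ω))
      = finner n (k - 1) (inter n k U ⇑ω) (inter n k U ⇑ω) ∧
    0 ≤ (-1 : ℝ) ^ (k - 1) *
        finner n k (reind n (by omega : k - 1 + 1 = k) (EU n k U ⇑ω))
          (reind n (by omega : k - 1 + 1 = k) (EU n k U ⇑ω)) ∧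
    0 ≤ (-1 : ℝ) ^ k * finner n k (BU n k U ⇑ω) (BU n k U ⇑ω) ∧
    0 ≤ (-1 : ℝ) ^ (k - 1) * finner n (k - 1) (inter n k U ⇑ω) (inter n k U ⇑ω) ∧
    0 ≤ (-1 : ℝ) ^ k *
        finner n (k + 1) (wedge1 n k (ustar n U) ⇑ω) (wedge1 n k (ustar n U) ⇑ω) := by
  obtain ⟨m, rfl⟩ : ∃ m, k = m + 1 := ⟨k - 1, by omega⟩
  have hE : reind n (by omega : m + 1 - 1 + 1 = m + 1) (EU n (m + 1) U ⇑ω)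
      = ⇑(wedgeAlt U (ω.curryLeft U)) := by
    rw [coe_wedgeAlt, coe_curryLeft]; rfl
  have hB : BU n (m + 1) U ⇑ω = ⇑((wedgeAlt U ω).curryLeft U) := by
    rw [coe_curryLeft, coe_wedgeAlt]; rfl
  have hI : finner n (m + 1 - 1) (inter n (m + 1) U ⇑ω) (inter n (m + 1) U ⇑ω)
      = finner n m (ω.curryLeft U) (ω.curryLeft U) := by
    rw [coe_curryLeft]; rfl
  have hEI : finner n (m + 1) (wedgeAlt U (ω.curryLeft U)) (wedgeAlt U (ω.curryLeft U))
      = finner n m (ω.curryLeft U) (ω.curryLeft U) := by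
    rw [finner_wedgeAlt, curryLeft_wedgeAlt_curryLeft hU.1]
  have hEpos : 0 ≤ (-1 : ℝ) ^ m * finner n m (ω.curryLeft U) (ω.curryLeft U) :=
    neg_one_pow_mul_finner_self_nonneg hU _ (curryLeft_apply_eq_zero_of_eq U ω)
  have hBpos := neg_one_pow_mul_finner_self_nonneg hU _
    (curryLeft_apply_eq_zero_of_eq U (wedgeAlt U ω))
  rw [hE, hB, hI, hEI, ← coe_wedgeAlt, finner_wedgeAlt_self hU.1]
  exact ⟨rfl, hEpos, hBpos, hEpos, hBpos⟩

end Paper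
end

section
/- Fix n ≥ 1 and 1 ≤ k ≤ 1+n, and let ω be a smooth k-form field on an open set W ⊆ ℝ^{1+n} with the flat Minkowski metric η. Define the 2-covariant tensor field S_{ab} := (1/(k−1)!) ω_a{}^{i₂…i_k} ω_{b i₂…i_k} (the components of ⟨i_−ω, i_−ω⟩). Then for every index b and every point of W: Σ_{a=0}^{n} ε_a ∂_a S_{ab} = (−1)^{k−1} ( (i_ω dω)_b − (i_{∂ω} ω)_b ) + (1/2) ∂_b ⟨ω, ω⟩. -/
namespace Paper

noncomputable section

/-- Points of `ℝ^{1+n}`. -/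
abbrev Pt (n : ℕ) := Fin (n + 1) → ℝ

/-- Partial derivative `∂_a f` of a scalar function. -/
def pd (n : ℕ) (a : Fin (n + 1)) (f : Pt n → ℝ) (x : Pt n) : ℝ :=
  fderiv ℝ f x (Pi.single a 1)

/-- The flat Minkowski metric `η_{ab} = ε_a δ_{ab}`. -/
def etaM (n : ℕ) (a b : Fin (n + 1)) : ℝ := if a = b then eps n a else 0

/-- Prepend an entry to an index tuple: `(a, v₁, …, v_{k-1})`. -/
def dcons {α : Type*} (k : ℕ) (a : α) (v : Fin (k - 1) → α) : Fin k → α :=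
  fun j => if h : (j : ℕ) = 0 then a else v ⟨(j : ℕ) - 1, by have := j.isLt; omega⟩

/-- Append an entry to an index tuple: `(v₁, …, v_{k-1}, b)`. -/
def dsnoc {α : Type*} (k : ℕ) (v : Fin (k - 1) → α) (b : α) : Fin k → α :=
  fun j => if h : (j : ℕ) < k - 1 then v ⟨(j : ℕ), h⟩ else b

/-- The tail `(w₂, …, w_k)` of an index tuple. -/
def dtail {α : Type*} (k : ℕ) (w : Fin k → α) : Fin (k - 1) → α :=
  fun j => w ⟨(j : ℕ) + 1, by have := j.isLt; omega⟩

/-- `ω` is a smooth `k`-form field on `W`: smooth antisymmetric components. -/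
def IsFormFieldOn (n k : ℕ) (W : Set (Pt n)) (ω : Pt n → (Fin k → Fin (n + 1)) → ℝ) : Prop :=
  (∀ v, ContDiffOn ℝ (⊤ : ℕ∞) (fun x => ω x v) W) ∧
  (∀ x ∈ W, ∀ (v : Fin k → Fin (n + 1)) (σ : Equiv.Perm (Fin k)),
    ω x (v ∘ σ) = ((Equiv.Perm.sign σ : ℤ) : ℝ) * ω x v)

/-- The exterior differential: `(dω)_{i₀…i_k} = Σ_j (−1)^j ∂_{i_j} ω_{i₀…î_j…i_k}`. -/
def dflat (n k : ℕ) (ω : Pt n → (Fin k → Fin (n + 1)) → ℝ) (x : Pt n)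
    (u : Fin (k + 1) → Fin (n + 1)) : ℝ :=
  ∑ j : Fin (k + 1), (-1 : ℝ) ^ (j : ℕ) * pd n (u j) (fun y => ω y (u ∘ j.succAbove)) x

/-- The codifferential: `(∂ω)_{i₁…i_{k−1}} = −Σ_a ε_a ∂_a ω_{a i₁…i_{k−1}}`. -/
def cdflat (n k : ℕ) (ω : Pt n → (Fin k → Fin (n + 1)) → ℝ) (x : Pt n)
    (v : Fin (k - 1) → Fin (n + 1)) : ℝ :=
  -∑ a, eps n a * pd n a (fun y => ω y (dcons k a v)) x

/-- `(i_{∂ω}ω)_b = (1/(k−1)!) (∂ω)^{i₂…i_k} ω_{i₂…i_k b}` (indices raised with `η`). -/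
def icd (n k : ℕ) (ω : Pt n → (Fin k → Fin (n + 1)) → ℝ) (x : Pt n) (b : Fin (n + 1)) : ℝ :=
  (1 / ((k - 1).factorial : ℝ)) * ∑ v : Fin (k - 1) → Fin (n + 1),
    (∏ j, eps n (v j)) * cdflat n k ω x v * ω x (dsnoc k v b)

/-- `(i_ω dω)_b = (1/k!) ω^{i₁…i_k} (dω)_{i₁…i_k b}` (indices raised with `η`). -/
def iwd (n k : ℕ) (ω : Pt n → (Fin k → Fin (n + 1)) → ℝ) (x : Pt n) (b : Fin (n + 1)) : ℝ :=
  (1 / (k.factorial : ℝ)) * ∑ v : Fin k → Fin (n + 1),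
    (∏ j, eps n (v j)) * ω x v * dflat n k ω x (dsnoc (k + 1) v b)

/-- The scalar square `⟨ω,ω⟩ = (1/k!) ω^{i₁…i_k} ω_{i₁…i_k}`. -/
def sqn (n k : ℕ) (ω : Pt n → (Fin k → Fin (n + 1)) → ℝ) (x : Pt n) : ℝ :=
  (1 / (k.factorial : ℝ)) * ∑ v : Fin k → Fin (n + 1),
    (∏ j, eps n (v j)) * ω x v * ω x v

/-- The energy tensor field
`T_{ab} = ((−1)^{k−1}/(k−1)!)(ω_a{}^{i₂…i_k} ω_{b i₂…i_k} − (1/(2k)) ω^{i₁…i_k}ω_{i₁…i_k} η_{ab})`. -/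
def Tflat (n k : ℕ) (ω : Pt n → (Fin k → Fin (n + 1)) → ℝ) (x : Pt n)
    (a b : Fin (n + 1)) : ℝ :=
  ((-1 : ℝ) ^ (k - 1) / ((k - 1).factorial : ℝ)) *
    ((∑ v : Fin (k - 1) → Fin (n + 1),
        (∏ j, eps n (v j)) * ω x (dcons k a v) * ω x (dcons k b v))
      - (1 / (2 * (k : ℝ))) * (∑ w : Fin k → Fin (n + 1),
        (∏ j, eps n (w j)) * ω x w * ω x w) * etaM n a b)

/-- The tensor field `S_{ab} = (1/(k−1)!) ω_a{}^{i₂…i_k} ω_{b i₂…i_k}`,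
the components of `⟨i_−ω, i_−ω⟩`. -/
def Sflat (n k : ℕ) (ω : Pt n → (Fin k → Fin (n + 1)) → ℝ) (x : Pt n)
    (a b : Fin (n + 1)) : ℝ :=
  (1 / ((k - 1).factorial : ℝ)) * ∑ v : Fin (k - 1) → Fin (n + 1),
    (∏ j, eps n (v j)) * ω x (dcons k a v) * ω x (dcons k b v)

/-- The volume form `dX` on index tuples: `dX(e_{u₀},…,e_{u_n})`. -/
def dXc (n : ℕ) (u : Fin (n + 1) → Fin (n + 1)) : ℝ :=
  Matrix.det (Matrix.of fun i j => if u i = j then (1 : ℝ) else 0)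

end

end Paper

namespace Paper

theorem dcons_succ {α : Type*} (m : ℕ) (a : α) (v : Fin m → α) :
    dcons (m + 1) a v = Fin.cons a v := by
  funext j
  refine Fin.cases ?_ (fun i => ?_) j <;> simp [dcons]

theorem dsnoc_succ {α : Type*} (m : ℕ) (v : Fin m → α) (b : α) :
    dsnoc (m + 1) v b = Fin.snoc v b := by
  funext j
  refine Fin.lastCases ?_ (fun i => ?_) j <;> simp [dsnoc]

theorem Sflat_succ (n m : ℕ) (ω : Pt n → (Fin (m + 1) → Fin (n + 1)) → ℝ) (x : Pt n)
    (a b : Fin (n + 1)) :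
    Sflat n (m + 1) ω x a b = (1 / (m.factorial : ℝ)) * ∑ v : Fin m → Fin (n + 1),
      (∏ j, eps n (v j)) * ω x (Fin.cons a v) * ω x (Fin.cons b v) := by
  simp only [Sflat, dcons_succ]
  rfl

theorem icd_succ (n m : ℕ) (ω : Pt n → (Fin (m + 1) → Fin (n + 1)) → ℝ) (x : Pt n)
    (b : Fin (n + 1)) :
    icd n (m + 1) ω x b = (1 / (m.factorial : ℝ)) * ∑ v : Fin m → Fin (n + 1),
      (∏ j, eps n (v j)) * (-∑ a, eps n a * pd n a (fun y => ω y (Fin.cons a v)) x) *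
        ω x (Fin.snoc v b) := by
  simp only [icd, cdflat, dcons_succ, dsnoc_succ]
  rfl

/-- Antisymmetry of a family of components indexed by tuples. -/
def IsAntisymm {α : Type*} {k : ℕ} (G : (Fin k → α) → ℝ) : Prop :=
  ∀ (v : Fin k → α) (σ : Equiv.Perm (Fin k)), G (v ∘ σ) = ((Equiv.Perm.sign σ : ℤ) : ℝ) * G v

namespace IsAntisymm

variable {α : Type*} {m : ℕ} {G : (Fin (m + 1) → α) → ℝ}

theorem snoc (hG : IsAntisymm G) (v : Fin m → α) (b : α) :
    G (Fin.snoc v b) = (-1) ^ m * G (Fin.cons b v) := by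
  have h := hG (Fin.cons b v) (finRotate (m + 1))
  rw [sign_finRotate] at h
  have e : (Fin.cons b v : Fin (m + 1) → α) ∘ finRotate (m + 1) = Fin.snoc v b := by
    rw [Fin.snoc_eq_cons_rotate]
    rfl
  rw [e] at h
  simpa using h

theorem insertNth (hG : IsAntisymm G) (j : Fin (m + 1)) (a : α) (v : Fin m → α) :
    G (j.insertNth a v) = (-1) ^ (j : ℕ) * G (Fin.cons a v) := by
  have h := hG (Fin.cons a v) (Fin.cycleRange j)
  rw [Fin.sign_cycleRange] at h
  have e : (Fin.cons a v : Fin (m + 1) → α) ∘ Fin.cycleRange j = j.insertNth a v := by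
    funext i
    simp
  rw [e] at h
  simpa using h

end IsAntisymm

theorem snoc_insertNth_comp_succAbove {α : Type*} {m : ℕ} (j : Fin (m + 1)) (a b : α)
    (v : Fin m → α) :
    (Fin.snoc (j.insertNth a v : Fin (m + 1) → α) b : Fin (m + 2) → α) ∘ j.castSucc.succAbove
      = Fin.snoc v b := by
  funext i
  refine Fin.lastCases ?_ (fun i => ?_) i
  · have : j.castSucc.succAbove (Fin.last m) = Fin.last (m + 1) := by
      rw [Fin.succAbove_of_le_castSucc _ _ (by simpa using Fin.le_last j)]
      simp
    simp [this]
  · have : j.castSucc.succAbove i.castSucc = (j.succAbove i).castSucc := by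
      simp [Fin.castSucc_succAbove_castSucc]
    simp [this]

theorem snoc_comp_succAbove_last {α : Type*} {m : ℕ} (w : Fin m → α) (b : α) :
    (Fin.snoc w b : Fin (m + 1) → α) ∘ (Fin.last m).succAbove = w := by
  funext i
  simp

/-- Summing over all tuples after splitting off the `j`-th entry. -/
theorem sum_tuple_eq_sum_insertNth {α : Type*} [Fintype α] {m : ℕ} (j : Fin (m + 1))
    (f : (Fin (m + 1) → α) → ℝ) :
    ∑ w, f w = ∑ v : Fin m → α, ∑ a, f (j.insertNth a v) := by
  rw [← (Fin.insertNthEquiv (fun _ => α) j).sum_comp, Fintype.sum_prod_type, Finset.sum_comm]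
  rfl

namespace IsFormFieldOn

variable {n k : ℕ} {W : Set (Pt n)} {ω : Pt n → (Fin k → Fin (n + 1)) → ℝ} {x : Pt n}

theorem differentiableAt (hω : IsFormFieldOn n k W ω) (hW : IsOpen W) (hx : x ∈ W)
    (v : Fin k → Fin (n + 1)) : DifferentiableAt ℝ (fun y => ω y v) x :=
  ((hω.1 v).contDiffAt (hW.mem_nhds hx)).differentiableAt (by simp)

theorem isAntisymm_pd (hω : IsFormFieldOn n k W ω) (hW : IsOpen W) (hx : x ∈ W)
    (a : Fin (n + 1)) : IsAntisymm fun v => pd n a (fun y => ω y v) x := by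
  intro v σ
  have h : (fun y => ω y (v ∘ σ)) =ᶠ[nhds x]
      fun y => ((Equiv.Perm.sign σ : ℤ) : ℝ) * ω y v := by
    filter_upwards [hW.mem_nhds hx] with y hy using hω.2 y hy v σ
  simp only [pd]
  rw [h.fderiv_eq, fderiv_const_mul (hω.differentiableAt hW hx v)]
  simp

end IsFormFieldOn

theorem pd_const_mul_sum {n : ℕ} {ι : Type*} [Fintype ι] (b : Fin (n + 1)) (c : ℝ) (e : ι → ℝ)
    {f g : ι → Pt n → ℝ} {x : Pt n} (hf : ∀ i, DifferentiableAt ℝ (f i) x)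
    (hg : ∀ i, DifferentiableAt ℝ (g i) x) :
    pd n b (fun y => c * ∑ i, e i * f i y * g i y) x
      = c * ∑ i, e i * (f i x * pd n b (g i) x + pd n b (f i) x * g i x) := by
  have h : HasFDerivAt (fun y => c * ∑ i, e i * f i y * g i y)
      (c • ∑ i, ((e i * f i x) • fderiv ℝ (g i) x + g i x • e i • fderiv ℝ (f i) x)) x :=
    (HasFDerivAt.fun_sum fun i _ =>
      ((hf i).hasFDerivAt.const_mul (e i)).mul (hg i).hasFDerivAt).const_mul c
  simp only [pd]
  rw [h.fderiv]
  simp only [smul_apply, sum_apply, add_apply, smul_eq_mul]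
  congr 1
  exact Finset.sum_congr rfl fun i _ => by ring

/-- The part of `(i_ω dω)_b` in which `b` is an index of `ω` rather than of the derivative. -/
theorem sum_mul_dflat_snoc {n m : ℕ} {W : Set (Pt n)}
    {ω : Pt n → (Fin (m + 1) → Fin (n + 1)) → ℝ} (hω : IsFormFieldOn n (m + 1) W ω)
    (hW : IsOpen W) {x : Pt n} (hx : x ∈ W) (b : Fin (n + 1)) :
    ∑ w : Fin (m + 1) → Fin (n + 1), (∏ j, eps n (w j)) * ω x w *
        dflat n (m + 1) ω x (Fin.snoc w b)
      = (-1) ^ m * ((m + 1 : ℕ) * ∑ v : Fin m → Fin (n + 1), ∑ a, (∏ j, eps n (v j)) * eps n a *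
            ω x (Fin.cons a v) * pd n a (fun y => ω y (Fin.cons b v)) x
          - ∑ w : Fin (m + 1) → Fin (n + 1), (∏ j, eps n (w j)) * ω x w *
            pd n b (fun y => ω y w) x) := by
  have hx' : IsAntisymm (ω x) := hω.2 x hx
  have hsplit : ∀ w : Fin (m + 1) → Fin (n + 1), dflat n (m + 1) ω x (Fin.snoc w b)
      = (∑ j : Fin (m + 1), (-1) ^ (j : ℕ) * pd n (w j) (fun y => ω y
          ((Fin.snoc w b : Fin (m + 2) → Fin (n + 1)) ∘ j.castSucc.succAbove)) x)
        - (-1) ^ m * pd n b (fun y => ω y w) x := by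
    intro w
    rw [dflat, Fin.sum_univ_castSucc]
    simp only [Fin.snoc_castSucc, Fin.snoc_last, Fin.val_castSucc, Fin.val_last,
      snoc_comp_succAbove_last]
    ring
  have hj : ∀ j : Fin (m + 1), ∑ w : Fin (m + 1) → Fin (n + 1), (∏ i, eps n (w i)) * ω x w *
        ((-1) ^ (j : ℕ) * pd n (w j) (fun y => ω y
          ((Fin.snoc w b : Fin (m + 2) → Fin (n + 1)) ∘ j.castSucc.succAbove)) x)
      = (-1) ^ m * ∑ v : Fin m → Fin (n + 1), ∑ a, (∏ i, eps n (v i)) * eps n a *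
          ω x (Fin.cons a v) * pd n a (fun y => ω y (Fin.cons b v)) x := by
    intro j
    rw [sum_tuple_eq_sum_insertNth j, Finset.mul_sum]
    refine Finset.sum_congr rfl fun v _ => ?_
    rw [Finset.mul_sum]
    refine Finset.sum_congr rfl fun a _ => ?_
    have hprod : ∏ i, eps n ((j.insertNth a v : Fin (m + 1) → Fin (n + 1)) i)
        = eps n a * ∏ i, eps n (v i) := by
      rw [Fin.prod_univ_succAbove _ j]
      simp
    have hpd := (hω.isAntisymm_pd hW hx a).snoc v b
    have hsq : ((-1 : ℝ) ^ (j : ℕ)) * (-1) ^ (j : ℕ) = 1 := by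
      rw [← mul_pow]
      simp
    rw [hprod, hx'.insertNth, snoc_insertNth_comp_succAbove, Fin.insertNth_apply_same, hpd]
    linear_combination (eps n a * (∏ i, eps n (v i)) * ω x (Fin.cons a v) *
      ((-1) ^ m * pd n a (fun y => ω y (Fin.cons b v)) x)) * hsq
  simp only [hsplit, mul_sub, Finset.sum_sub_distrib]
  congr 1
  · simp_rw [Finset.mul_sum (Finset.univ : Finset (Fin (m + 1)))]
    rw [Finset.sum_comm, Finset.sum_congr rfl fun j _ => hj j, Finset.sum_const,
      Finset.card_univ, Fintype.card_fin, nsmul_eq_mul]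
    ring
  · rw [Finset.mul_sum]
    exact Finset.sum_congr rfl fun w _ => by ring

/-- `div ⟨i_−ω,i_−ω⟩ = (−1)^{k−1}(i_ω dω − i_{∂ω}ω) + (1/2) d⟨ω,ω⟩`. -/
theorem statement16 (n k : ℕ) (hn : 1 ≤ n) (hk1 : 1 ≤ k) (hk2 : k ≤ n + 1)
    (W : Set (Pt n)) (hW : IsOpen W)
    (ω : Pt n → (Fin k → Fin (n + 1)) → ℝ) (hω : IsFormFieldOn n k W ω) :
    ∀ x ∈ W, ∀ b : Fin (n + 1),
      (∑ a, eps n a * pd n a (fun y => Sflat n k ω y a b) x)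
        = (-1 : ℝ) ^ (k - 1) * (iwd n k ω x b - icd n k ω x b)
          + (1 / 2) * pd n b (fun y => sqn n k ω y) x := by
  intro x hx b
  obtain ⟨m, rfl⟩ : ∃ m, k = m + 1 := ⟨k - 1, by omega⟩
  have hd := hω.differentiableAt hW hx
  have hsnoc : ∀ v b, ω x (Fin.snoc v b) = (-1) ^ m * ω x (Fin.cons b v) :=
    IsAntisymm.snoc (hω.2 x hx)
  have hneg : ((-1 : ℝ) ^ m) * (-1) ^ m = 1 := by
    rw [← mul_pow]
    simp
  have hfac : (((m + 1).factorial : ℕ) : ℝ) = ((m + 1 : ℕ) : ℝ) * (m.factorial : ℝ) := by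
    rw [Nat.factorial_succ, Nat.cast_mul]
  have hm : ((m + 1 : ℕ) : ℝ) ≠ 0 := by positivity
  have hm' : (m.factorial : ℝ) ≠ 0 := by positivity
  set A := ∑ v : Fin m → Fin (n + 1), ∑ a, (∏ j, eps n (v j)) * eps n a *
    ω x (Fin.cons a v) * pd n a (fun y => ω y (Fin.cons b v)) x with hA
  set B := ∑ v : Fin m → Fin (n + 1), ∑ a, (∏ j, eps n (v j)) * eps n a *
    pd n a (fun y => ω y (Fin.cons a v)) x * ω x (Fin.cons b v) with hB
  set C := ∑ w : Fin (m + 1) → Fin (n + 1), (∏ j, eps n (w j)) * ω x w *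
    pd n b (fun y => ω y w) x with hC
  have hS : ∑ a, eps n a * pd n a (fun y => Sflat n (m + 1) ω y a b) x
      = 1 / (m.factorial : ℝ) * (A + B) := by
    simp only [Sflat_succ]
    simp_rw [pd_const_mul_sum _ _ _ (fun _ => hd _) (fun _ => hd _)]
    rw [hA, hB, ← Finset.sum_add_distrib]
    simp_rw [← Finset.sum_add_distrib, Finset.mul_sum]
    rw [Finset.sum_comm]
    exact Finset.sum_congr rfl fun v _ => Finset.sum_congr rfl fun a _ => by ring
  have hicd : icd n (m + 1) ω x b = -(1 / (m.factorial : ℝ) * ((-1) ^ m * B)) := by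
    simp only [icd_succ, hsnoc]
    rw [hB, ← mul_neg, ← mul_neg, ← Finset.sum_neg_distrib, Finset.mul_sum (a := (-1 : ℝ) ^ m)]
    congr 1
    refine Finset.sum_congr rfl fun v _ => ?_
    rw [mul_neg, neg_mul, mul_neg, neg_inj, Finset.mul_sum, Finset.sum_mul, Finset.mul_sum]
    exact Finset.sum_congr rfl fun a _ => by ring
  have hiwd : iwd n (m + 1) ω x b
      = 1 / ((m + 1).factorial : ℝ) * ((-1) ^ m * ((m + 1 : ℕ) * A - C)) := by
    simp only [iwd, dsnoc_succ]
    rw [sum_mul_dflat_snoc hω hW hx b]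
  have hsqn : pd n b (fun y => sqn n (m + 1) ω y) x
      = 1 / ((m + 1).factorial : ℝ) * (2 * C) := by
    simp only [sqn]
    rw [pd_const_mul_sum _ _ _ (fun _ => hd _) (fun _ => hd _), hC, Finset.mul_sum (a := (2 : ℝ))]
    congr 1
    exact Finset.sum_congr rfl fun w _ => by ring
  rw [hS, hicd, hiwd, hsqn, hfac, Nat.add_sub_cancel]
  generalize (-1 : ℝ) ^ m = s at hneg
  have hs : s ^ 2 = 1 := by rw [sq, hneg]
  field_simp
  linear_combination (-(((m + 1 : ℕ) : ℝ) * (A + B) - C)) * hs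

end Paper
end
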